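/- arXiv:1003.3113 — 2 statements merged into one kernel-verified Lean document; each statement's English description precedes it below -/
import Mathlib

section
/- (Theorem 3.1) Let α(s) = (s, y(s), z(s)) be an admissible curve in the Galilean space G₃ with tangent T(s) = (1, y'(s), z'(s)), and let α*(s) = α(s) + λ(s)·T(s), with λ differentiable, be an involute of α (so that ⟨T(s), (α*)'(s)⟩_G = 0 for all s). Then, with c = λ(0), the Galilean distance between corresponding points satisfies ‖α*(s) − α(s)‖_G = |c − s| for all s. -/
open Classical in
/-- The Galilean scalar product on `ℝ × ℝ × ℝ`. -/
noncomputable def galInner (u v : ℝ × ℝ × ℝ) : ℝ :=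
  if u.1 ≠ 0 ∨ v.1 ≠ 0 then u.1 * v.1 else u.2.1 * v.2.1 + u.2.2 * v.2.2

open Classical in
/-- The Galilean norm on `ℝ × ℝ × ℝ`. -/
noncomputable def galNorm (u : ℝ × ℝ × ℝ) : ℝ :=
  if u.1 ≠ 0 then |u.1| else Real.sqrt (u.2.1 ^ 2 + u.2.2 ^ 2)

/-- Theorem 3.1: if `α*(s) = α(s) + λ(s)·T(s)` is an involute of the admissible
curve `α(s) = (s, y(s), z(s))` in the Galilean space `G₃`, then the Galilean
distance between corresponding points is `‖α*(s) - α(s)‖_G = |c - s|` where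
`c = λ(0)`. -/
theorem involute_dist_eq
    (y z lam : ℝ → ℝ)
    (hy : ContDiff ℝ 3 y) (hz : ContDiff ℝ 3 z)
    (hlam : Differentiable ℝ lam)
    (α : ℝ → ℝ × ℝ × ℝ) (hα : ∀ s, α s = (s, y s, z s))
    (T : ℝ → ℝ × ℝ × ℝ) (hT : ∀ s, T s = (1, deriv y s, deriv z s))
    (αstar : ℝ → ℝ × ℝ × ℝ) (hαstar : ∀ s, αstar s = α s + lam s • T s)
    (hinv : ∀ s, galInner (T s) (deriv αstar s) = 0) :
    ∀ s, galNorm (αstar s - α s) = |lam 0 - s| := by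
  have hastar : αstar =
      fun t => (t + lam t, y t + lam t * deriv y t, z t + lam t * deriv z t) := by
    funext t
    simp [hαstar, hα, hT]
  have hy' : Differentiable ℝ y := hy.differentiable (by norm_num)
  have hz' : Differentiable ℝ z := hz.differentiable (by norm_num)
  have hy'' : Differentiable ℝ (deriv y) :=
    (hy.of_le (by norm_num)).differentiable_deriv_two
  have hz'' : Differentiable ℝ (deriv z) :=
    (hz.of_le (by norm_num)).differentiable_deriv_two
  have hfst (t : ℝ) : (deriv αstar t).1 = 1 + deriv lam t := by
    have hd : HasDerivAt αstar (deriv αstar t) t := by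
      rw [hastar]
      exact DifferentiableAt.hasDerivAt (by fun_prop)
    have h₁ : HasDerivAt (fun s => s + lam s) (deriv αstar t).1 t := by
      simpa [hastar] using hd.hasFDerivAt.fst.hasDerivAt
    exact h₁.unique ((hasDerivAt_id t).add (hlam t).hasDerivAt)
  have hsum (t : ℝ) : t + lam t = 0 + lam 0 := by
    refine is_const_of_deriv_eq_zero (f := fun s => s + lam s) (by fun_prop) (fun s => ?_) t 0
    have h := hinv s
    simp only [galInner, hT, hfst, ne_eq, one_ne_zero, not_false_eq_true, true_or, if_true,
      one_mul] at h
    exact ((hasDerivAt_id s).add (hlam s).hasDerivAt).deriv.trans h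
  intro s
  have hlam_eq : lam 0 - s = lam s := by linarith [hsum s]
  by_cases h : lam s = 0 <;> simp [galNorm, hαstar, hT, hlam_eq, h]
end

section
/- (Equation 3.9) Let α(s) = (s, y(s), z(s)) be an admissible curve in the Galilean space G₃ with positive curvature κ(s) = √(y''(s)² + z''(s)²) and torsion τ(s) = det(α'(s), α''(s), α'''(s))/κ(s)², and suppose τ(s) > 0 for all s. Then the principal normal of the involute of α equals the binormal of α: for all s, N'(s)/‖N'(s)‖_G = B(s), where N(s) = (1/κ(s))·(0, y''(s), z''(s)) and B(s) = (1/κ(s))·(0, −z''(s), y''(s)). -/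
/-- The determinant of the 3×3 matrix whose rows are `u`, `v`, `w`. -/
def det3 (u v w : ℝ × ℝ × ℝ) : ℝ :=
  Matrix.det !![u.1, u.2.1, u.2.2; v.1, v.2.1, v.2.2; w.1, w.2.1, w.2.2]

/-- The Galilean norm of an isotropic vector is its Euclidean norm. -/
theorem galNorm_zero_left (p q : ℝ) : galNorm ((0 : ℝ), p, q) = Real.sqrt (p ^ 2 + q ^ 2) := by
  simp [galNorm]

/-- The derivative of the first coordinate of a normalized plane vector field. -/
theorem HasDerivAt.inv_mul_of_sq_eq {a b k : ℝ → ℝ} {a' b' k' s : ℝ}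
    (ha : HasDerivAt a a' s) (hb : HasDerivAt b b' s) (hk : HasDerivAt k k' s) (hk0 : k s ≠ 0)
    (hsq : ∀ t, k t ^ 2 = a t ^ 2 + b t ^ 2) :
    HasDerivAt (fun t => (k t)⁻¹ * a t) ((a s * b' - b s * a') / k s ^ 2 * ((k s)⁻¹ * -b s)) s := by
  have hkk : k s * k' = a s * a' + b s * b' := by
    have h₁ := (hk.fun_pow 2).unique
      (((ha.fun_pow 2).fun_add (hb.fun_pow 2)).congr_of_eventuallyEq (.of_forall hsq))
    norm_num at h₁
    linarith
  refine ((hk.fun_inv hk0).fun_mul ha).congr_deriv ?_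
  field_simp
  linear_combination a' * hsq s - a s * hkk

/-- Equation 3.9: for an admissible curve `α(s) = (s, y(s), z(s))` in `G₃` with
positive differentiable curvature `κ` and positive torsion `τ`, the principal
normal of the involute of `α` equals the binormal of `α`:
`N'(s)/‖N'(s)‖_G = B(s)`. -/
theorem involute_normal_eq_binormal
    (y z : ℝ → ℝ)
    (hy : ContDiff ℝ 3 y) (hz : ContDiff ℝ 3 z)
    (κ τ : ℝ → ℝ)
    (hκ : ∀ s, κ s = Real.sqrt (deriv (deriv y) s ^ 2 + deriv (deriv z) s ^ 2))
    (hκpos : ∀ s, 0 < κ s)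
    (hκdiff : Differentiable ℝ κ)
    (hτ : ∀ s, τ s = det3 ((1 : ℝ), deriv y s, deriv z s)
        ((0 : ℝ), deriv (deriv y) s, deriv (deriv z) s)
        ((0 : ℝ), deriv (deriv (deriv y)) s, deriv (deriv (deriv z)) s) / κ s ^ 2)
    (hτpos : ∀ s, 0 < τ s)
    (N B : ℝ → ℝ × ℝ × ℝ)
    (hN : ∀ s, N s = (κ s)⁻¹ • ((0 : ℝ), deriv (deriv y) s, deriv (deriv z) s))
    (hB : ∀ s, B s = (κ s)⁻¹ • ((0 : ℝ), -deriv (deriv z) s, deriv (deriv y) s)) :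
    ∀ s, (galNorm (deriv N s))⁻¹ • deriv N s = B s := by
  intro s
  have hsq : ∀ t, κ t ^ 2 = deriv (deriv y) t ^ 2 + deriv (deriv z) t ^ 2 := fun t => by
    rw [hκ, Real.sq_sqrt (by positivity)]
  have second_deriv {f : ℝ → ℝ} (hf : ContDiff ℝ 3 f) :
      HasDerivAt (deriv (deriv f)) (deriv (deriv (deriv f)) s) s := by
    have h := hf.differentiable_iteratedDeriv 2 (by norm_num)
    rw [iteratedDeriv_succ, iteratedDeriv_one] at h
    exact (h s).hasDerivAt
  have hκ0 := (hκpos s).ne'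
  have hτs : τ s = (deriv (deriv y) s * deriv (deriv (deriv z)) s
      - deriv (deriv z) s * deriv (deriv (deriv y)) s) / κ s ^ 2 := by
    rw [hτ, det3, Matrix.det_fin_three]
    simp
  have hN' : deriv N s = τ s • B s := by
    have h₁ := (second_deriv hy).inv_mul_of_sq_eq (second_deriv hz)
      (hκdiff s).hasDerivAt hκ0 hsq
    have h₂ := (second_deriv hz).inv_mul_of_sq_eq (second_deriv hy)
      (hκdiff s).hasDerivAt hκ0 fun t => by rw [hsq, add_comm]
    have hN_eq : N = fun t =>
        ((0 : ℝ), (κ t)⁻¹ * deriv (deriv y) t, (κ t)⁻¹ * deriv (deriv z) t) := by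
      funext t
      simp [hN]
    rw [hN_eq, ((hasDerivAt_const s (0 : ℝ)).prodMk (h₁.prodMk h₂)).deriv, hB, hτs]
    ext
    · simp
    · simp
    · simp only [Prod.smul_mk, smul_eq_mul]
      ring
  have hnorm : galNorm (deriv N s) = τ s := by
    rw [hN', hB]
    simp only [Prod.smul_mk, smul_eq_mul, mul_zero, galNorm_zero_left]
    rw [← Real.sqrt_sq (hτpos s).le]
    congr 1
    rw [Real.sqrt_sq (hτpos s).le]
    field_simp
    linear_combination -τ s ^ 2 * hsq s
  rw [hnorm, hN', inv_smul_smul₀ (hτpos s).ne']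
end
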